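/- Let 1 ≤ P₂ ≤ P₁, θ₀ ∈ [0,1], and let a, q be integers with 1 ≤ q ≤ d·P^{(d̃+1)θ₀}, 0 ≤ a < q and gcd(a,q) = 1. Then for every α ∈ [0,1] with |αq − a| ≤ q·d^{−d₁}·P^{−1+(d̃+1)θ₀}, writing β := α − a/q, one has S_d(α) = d^{m−r}·P₁^{m+1}·P₂^{n−r+1}·q^{−(n+2)}·S_{a,q,d}·I(d^{d₁}Pβ) + O(d^{m−r+1}·P₁^{m+1}·P₂^{n−r+1}·P^{2(d̃+1)θ₀}·P₂^{−1}), the implied constant depending only on F, n, m and r. -/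

import Mathlib

open MvPolynomial MeasureTheory
open scoped BigOperators ENNReal Classical

noncomputable section

namespace PaperTM

/-- Index type for the `n + 2` variables `(x₀,…,x_r, y_{r+1},…,y_m, z_{m+1},…,z_{n+1})`. -/
abbrev Idx (n m r : ℕ) := Fin (r + 1) ⊕ (Fin (m - r) ⊕ Fin (n - m + 1))

/-- `e(t) = exp(2 π i t)`. -/
def eexp (t : ℝ) : ℂ := Complex.exp (2 * Real.pi * Complex.I * t)

variable {n m r : ℕ}

/-- Evaluation of `F` at a triple of vectors with entries in a commutative ring. -/
def evalF {R : Type} [CommRing R] (F : MvPolynomial (Idx n m r) ℤ)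
    (x : Fin (r + 1) → R) (y : Fin (m - r) → R) (z : Fin (n - m + 1) → R) : R :=
  MvPolynomial.aeval (Sum.elim x (Sum.elim y z)) F

/-- `F` is bihomogeneous of bidegree `(d₁, d₂)`:
`F(a𝐱, ab𝐲, b𝐳) = a^{d₁} b^{d₂} F(𝐱,𝐲,𝐳)` for all scalars `a, b`. -/
def Bihomogeneous (F : MvPolynomial (Idx n m r) ℤ) (d₁ d₂ : ℕ) : Prop :=
  ∀ (R : Type) [CommRing R], ∀ (a b : R) (x : Fin (r + 1) → R) (y : Fin (m - r) → R)
    (z : Fin (n - m + 1) → R),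
    evalF F (fun i => a * x i) (fun j => a * b * y j) (fun k => b * z k) =
      a ^ d₁ * b ^ d₂ * evalF F x y z

/-- The partial derivative `∂F/∂t_i`, viewed as a polynomial with complex coefficients. -/
def pderivC (F : MvPolynomial (Idx n m r) ℤ) (i : Idx n m r) :
    MvPolynomial (Idx n m r) ℂ :=
  MvPolynomial.map (Int.castRingHom ℂ) (MvPolynomial.pderiv i F)

/-- The ideal of `V₁* = {∂F/∂x_i = 0 (0 ≤ i ≤ r), ∂F/∂y_j = 0 (r+1 ≤ j ≤ m)}`. -/
def idealV1 (F : MvPolynomial (Idx n m r) ℤ) : Ideal (MvPolynomial (Idx n m r) ℂ) :=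
  Ideal.span ((Set.range fun i : Fin (r + 1) => pderivC F (Sum.inl i)) ∪
    (Set.range fun j : Fin (m - r) => pderivC F (Sum.inr (Sum.inl j))))

/-- The ideal of `V₂* = {∂F/∂y_j = 0 (r+1 ≤ j ≤ m), ∂F/∂z_k = 0 (m+1 ≤ k ≤ n+1)}`. -/
def idealV2 (F : MvPolynomial (Idx n m r) ℤ) : Ideal (MvPolynomial (Idx n m r) ℂ) :=
  Ideal.span ((Set.range fun j : Fin (m - r) => pderivC F (Sum.inr (Sum.inl j))) ∪
    (Set.range fun k : Fin (n - m + 1) => pderivC F (Sum.inr (Sum.inr k))))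

/-- The dimension of the affine variety `V₁* ⊆ ℂ^{n+2}`. -/
def dimV1 (F : MvPolynomial (Idx n m r) ℤ) : WithBot ℕ∞ :=
  ringKrullDim (MvPolynomial (Idx n m r) ℂ ⧸ idealV1 F)

/-- The dimension of the affine variety `V₂* ⊆ ℂ^{n+2}`. -/
def dimV2 (F : MvPolynomial (Idx n m r) ℤ) : WithBot ℕ∞ :=
  ringKrullDim (MvPolynomial (Idx n m r) ℂ ⧸ idealV2 F)

/-- The polynomial `F(𝐱, 𝐘, 𝐙)` with complex coefficients obtained from `F` by specializing
the variables `𝐱` to a fixed point of `ℂ^{r+1}`. -/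
def subsX (x : Fin (r + 1) → ℂ) (p : MvPolynomial (Idx n m r) ℤ) :
    MvPolynomial (Fin (m - r) ⊕ Fin (n - m + 1)) ℂ :=
  MvPolynomial.aeval (Sum.elim (fun i => MvPolynomial.C (x i))
    (Sum.elim (fun j => MvPolynomial.X (Sum.inl j)) (fun k => MvPolynomial.X (Sum.inr k)))) p

/-- Specialization of the variables `𝐳` to a fixed point of `ℂ^{n-m+1}`. -/
def subsZ (z : Fin (n - m + 1) → ℂ) (p : MvPolynomial (Idx n m r) ℤ) :
    MvPolynomial (Fin (r + 1) ⊕ Fin (m - r)) ℂ :=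
  MvPolynomial.aeval (Sum.elim (fun i => MvPolynomial.X (Sum.inl i))
    (Sum.elim (fun j => MvPolynomial.X (Sum.inr j)) (fun k => MvPolynomial.C (z k)))) p

/-- Dimension of `V₂,𝐱* = {(𝐲,𝐳) : ∂F/∂y_j(𝐱,𝐲,𝐳) = 0, ∂F/∂z_k(𝐱,𝐲,𝐳) = 0}`. -/
def dimV2x (F : MvPolynomial (Idx n m r) ℤ) (x : Fin (r + 1) → ℂ) : WithBot ℕ∞ :=
  ringKrullDim (MvPolynomial (Fin (m - r) ⊕ Fin (n - m + 1)) ℂ ⧸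
    Ideal.span
      ((Set.range fun j : Fin (m - r) => subsX x (MvPolynomial.pderiv (Sum.inr (Sum.inl j)) F)) ∪
       (Set.range fun k : Fin (n - m + 1) => subsX x (MvPolynomial.pderiv (Sum.inr (Sum.inr k)) F))))

/-- Dimension of `V₁,𝐳* = {(𝐱,𝐲) : ∂F/∂x_i(𝐱,𝐲,𝐳) = 0, ∂F/∂y_j(𝐱,𝐲,𝐳) = 0}`. -/
def dimV1z (F : MvPolynomial (Idx n m r) ℤ) (z : Fin (n - m + 1) → ℂ) : WithBot ℕ∞ :=
  ringKrullDim (MvPolynomial (Fin (r + 1) ⊕ Fin (m - r)) ℂ ⧸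
    Ideal.span
      ((Set.range fun i : Fin (r + 1) => subsZ z (MvPolynomial.pderiv (Sum.inl i) F)) ∪
       (Set.range fun j : Fin (m - r) => subsZ z (MvPolynomial.pderiv (Sum.inr (Sum.inl j)) F))))

/-- The set `A₂^λ = {𝐱 ∈ ℂ^{r+1} : dim V₂,𝐱* < dim V₂* − (r+1) + λ}`, where `D₂ = dim V₂*`;
the inequality is stated equivalently as `dim V₂,𝐱* + (r+1) < D₂ + λ`. -/
def A2set (F : MvPolynomial (Idx n m r) ℤ) (lam D₂ : ℕ) : Set (Fin (r + 1) → ℂ) :=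
  {x | dimV2x F x + (((r + 1 : ℕ) : ℕ∞) : WithBot ℕ∞) < (((D₂ + lam : ℕ) : ℕ∞) : WithBot ℕ∞)}

/-- The set `A₁^μ = {𝐳 ∈ ℂ^{n-m+1} : dim V₁,𝐳* < dim V₁* − (n−m+1) + μ}`, where `D₁ = dim V₁*`. -/
def A1set (F : MvPolynomial (Idx n m r) ℤ) (mu D₁ : ℕ) : Set (Fin (n - m + 1) → ℂ) :=
  {z | dimV1z F z + (((n - m + 1 : ℕ) : ℕ∞) : WithBot ℕ∞) < (((D₁ + mu : ℕ) : ℕ∞) : WithBot ℕ∞)}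

/-- The exponential sum `S_d(α)`. -/
def Sd (F : MvPolynomial (Idx n m r) ℤ) (d : ℕ) (P₁ P₂ α : ℝ) : ℂ :=
  ∑' q : (Fin (r + 1) → ℤ) × (Fin (m - r) → ℤ) × (Fin (n - m + 1) → ℤ),
    if ‖q.1‖ ≤ P₁ ∧ ‖q.2.1‖ ≤ d * ‖q.1‖ * P₂ ∧ ‖q.2.2‖ ≤ P₂ then
      eexp (α * (evalF F (fun i => (d : ℤ) * q.1 i) q.2.1 q.2.2 : ℤ))
    else 0

/-- The complete exponential sum `S_{a,q,d}`. -/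
def Saqd (F : MvPolynomial (Idx n m r) ℤ) (d a q : ℕ) : ℂ :=
  ∑' b : (Fin (r + 1) → ZMod q) × (Fin (m - r) → ZMod q) × (Fin (n - m + 1) → ZMod q),
    eexp ((a : ℝ) / (q : ℝ) *
      ((evalF F (fun i => (d : ZMod q) * b.1 i) b.2.1 b.2.2).val : ℝ))

/-- The term `A_d(q) = q^{-(n+2)} ∑_{0 ≤ a < q, (a,q)=1} S_{a,q,d}` of the singular series. -/
def Aq (F : MvPolynomial (Idx n m r) ℤ) (d q : ℕ) : ℂ :=
  (q : ℂ) ^ (-((n : ℤ) + 2)) *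
    ∑ a ∈ (Finset.range q).filter fun a => Nat.gcd a q = 1, Saqd F d a q

/-- The singular series `𝔖_d`. -/
def singSeries (F : MvPolynomial (Idx n m r) ℤ) (d : ℕ) : ℂ := ∑' q : ℕ, Aq F d q

/-- The partial singular series `𝔖_d(Q)`. -/
def singSeriesPartial (F : MvPolynomial (Idx n m r) ℤ) (d Q : ℕ) : ℂ :=
  ∑ q ∈ Finset.Icc 1 Q, Aq F d q

/-- The integral `I(β)` over the region `|𝐮| ≤ 1`, `|𝐯| ≤ |𝐮|`, `|𝐰| ≤ 1`. -/
def Ibeta (F : MvPolynomial (Idx n m r) ℤ) (β : ℝ) : ℂ :=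
  ∫ p : (Fin (r + 1) → ℝ) × (Fin (m - r) → ℝ) × (Fin (n - m + 1) → ℝ),
    if ‖p.1‖ ≤ 1 ∧ ‖p.2.1‖ ≤ ‖p.1‖ ∧ ‖p.2.2‖ ≤ 1 then
      eexp (β * evalF F p.1 p.2.1 p.2.2)
    else 0

/-- The truncated singular integral `J(φ) = ∫_{|β| ≤ φ} I(β) dβ`. -/
def Jphi (F : MvPolynomial (Idx n m r) ℤ) (φ : ℝ) : ℂ :=
  ∫ β in Set.Icc (-φ) φ, Ibeta F β

/-- The singular integral `J = ∫_ℝ I(β) dβ`. -/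
def Jint (F : MvPolynomial (Idx n m r) ℤ) : ℂ := ∫ β : ℝ, Ibeta F β

/-- The constant `σ_d = d^{m-r-d₁} 𝔖_d J`. -/
def sigmaD (F : MvPolynomial (Idx n m r) ℤ) (d₁ d : ℕ) : ℂ :=
  (d : ℂ) ^ ((m : ℤ) - r - d₁) * singSeries F d * Jint F

/-- `S_{a,q,d}(𝐱)`, the complete exponential sum with `𝐱` fixed. -/
def SaqdX (F : MvPolynomial (Idx n m r) ℤ) (d : ℕ) (x : Fin (r + 1) → ℤ) (a q : ℕ) : ℂ :=
  ∑' b : (Fin (m - r) → ZMod q) × (Fin (n - m + 1) → ZMod q),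
    eexp ((a : ℝ) / (q : ℝ) *
      ((evalF F (fun i => ((d * x i : ℤ) : ZMod q)) b.1 b.2).val : ℝ))

/-- The singular series `𝔖_{d,𝐱} = ∑_q q^{-(n-r+1)} ∑_{(a,q)=1} S_{a,q,d}(𝐱)`. -/
def singSeriesX (F : MvPolynomial (Idx n m r) ℤ) (d : ℕ) (x : Fin (r + 1) → ℤ) : ℂ :=
  ∑' q : ℕ, (q : ℂ) ^ (-((n : ℤ) - r + 1)) *
    ∑ a ∈ (Finset.range q).filter fun a => Nat.gcd a q = 1, SaqdX F d x a q

/-- `I_𝐱(β) = ∫_{[-1,1]^{m-r} × [-1,1]^{n-m+1}} e(β F(𝐱, k𝐯, 𝐰)) d𝐯 d𝐰` with `k = |𝐱|`. -/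
def IbetaX (F : MvPolynomial (Idx n m r) ℤ) (x : Fin (r + 1) → ℤ) (β : ℝ) : ℂ :=
  ∫ p : (Fin (m - r) → ℝ) × (Fin (n - m + 1) → ℝ),
    if ‖p.1‖ ≤ 1 ∧ ‖p.2‖ ≤ 1 then
      eexp (β * evalF F (fun i => (x i : ℝ)) (fun j => ‖x‖ * p.1 j) p.2)
    else 0

/-- `J_{d,𝐱} = ∫_ℝ I_𝐱(d^{d₁} β) dβ`. -/
def JdX (F : MvPolynomial (Idx n m r) ℤ) (d₁ d : ℕ) (x : Fin (r + 1) → ℤ) : ℂ :=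
  ∫ β : ℝ, IbetaX F x ((d : ℝ) ^ d₁ * β)

/-- `S_{a,q,d}(𝐳)`, the complete exponential sum with `𝐳` fixed. -/
def SaqdZ (F : MvPolynomial (Idx n m r) ℤ) (d : ℕ) (z : Fin (n - m + 1) → ℤ) (a q : ℕ) : ℂ :=
  ∑' b : (Fin (r + 1) → ZMod q) × (Fin (m - r) → ZMod q),
    eexp ((a : ℝ) / (q : ℝ) *
      ((evalF F (fun i => (d : ZMod q) * b.1 i) b.2 (fun k => ((z k : ℤ) : ZMod q))).val : ℝ))

/-- The singular series `𝔖_{d,𝐳} = ∑_q q^{-(m+1)} ∑_{(a,q)=1} S_{a,q,d}(𝐳)`. -/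
def singSeriesZ (F : MvPolynomial (Idx n m r) ℤ) (d : ℕ) (z : Fin (n - m + 1) → ℤ) : ℂ :=
  ∑' q : ℕ, (q : ℂ) ^ (-((m : ℤ) + 1)) *
    ∑ a ∈ (Finset.range q).filter fun a => Nat.gcd a q = 1, SaqdZ F d z a q

/-- `I_𝐳(β) = ∫_{(𝐮,𝐯) ∈ [-1,1]^{r+1} × [-1,1]^{m-r}, |𝐯| < |𝐮|} e(β F(𝐮, l𝐯, 𝐳)) d𝐮 d𝐯`
with `l = |𝐳|`. -/
def IbetaZ (F : MvPolynomial (Idx n m r) ℤ) (z : Fin (n - m + 1) → ℤ) (β : ℝ) : ℂ :=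
  ∫ p : (Fin (r + 1) → ℝ) × (Fin (m - r) → ℝ),
    if ‖p.1‖ ≤ 1 ∧ ‖p.2‖ ≤ 1 ∧ ‖p.2‖ < ‖p.1‖ then
      eexp (β * evalF F p.1 (fun j => ‖z‖ * p.2 j) (fun k => (z k : ℝ)))
    else 0

/-- `J_𝐳 = ∫_ℝ I_𝐳(β) dβ`. -/
def JZ (F : MvPolynomial (Idx n m r) ℤ) (z : Fin (n - m + 1) → ℤ) : ℂ :=
  ∫ β : ℝ, IbetaZ F z β

/-- The major arcs `𝔐^{(1)}(θ)` (with `dt = d̃ = d₁ + d₂ - 2`). -/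
def majorArc1 (d d₁ dt : ℕ) (P θ : ℝ) : Set ℝ :=
  {α | α ∈ Set.Icc (0 : ℝ) 1 ∧ ∃ q a : ℕ, 0 < q ∧ d ∣ q ∧ a < q ∧
    (q : ℝ) ≤ d * P ^ (((dt : ℝ) + 1) * θ) ∧
    |α * q - a| ≤ ((d : ℝ) ^ (d₁ - 1))⁻¹ * P ^ (-1 + ((dt : ℝ) + 1) * θ)}

/-- The major arcs `𝔐^{(2)}(θ)`. -/
def majorArc2 (d d₁ dt : ℕ) (P θ : ℝ) : Set ℝ :=
  {α | α ∈ Set.Icc (0 : ℝ) 1 ∧ ∃ q a : ℕ, 0 < q ∧ a < q ∧ Nat.gcd a q = 1 ∧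
    (q : ℝ) ≤ P ^ (((dt : ℝ) + 1) * θ) ∧
    |α * q - a| ≤ ((d : ℝ) ^ d₁)⁻¹ * P ^ (-1 + ((dt : ℝ) + 1) * θ)}

/-- The minor arcs `𝔪(θ) = [0,1) \ (𝔐^{(1)}(θ) ∪ 𝔐^{(2)}(θ))`. -/
def minorArcs (d d₁ dt : ℕ) (P θ : ℝ) : Set ℝ :=
  Set.Ico (0 : ℝ) 1 \ (majorArc1 d d₁ dt P θ ∪ majorArc2 d d₁ dt P θ)

theorem norm_eexp (t : ℝ) : ‖eexp t‖ = 1 := by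
  rw [eexp, show (2 * Real.pi * Complex.I * t : ℂ) = ((2 * Real.pi * t : ℝ) : ℂ) * Complex.I by
    push_cast; ring]
  exact Complex.norm_exp_ofReal_mul_I _

theorem eexp_add (s t : ℝ) : eexp (s + t) = eexp s * eexp t := by
  simp only [eexp, ← Complex.exp_add]
  push_cast
  ring_nf

theorem eexp_intCast (k : ℤ) : eexp k = 1 := by
  rw [eexp, show (2 * Real.pi * Complex.I * ((k : ℝ) : ℂ) : ℂ) = k * (2 * Real.pi * Complex.I) by
    push_cast; ring]
  exact Complex.exp_int_mul_two_pi_mul_I k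

theorem continuous_eexp : Continuous eexp := by
  unfold eexp
  fun_prop

theorem norm_eexp_sub_le (s t : ℝ) : ‖eexp s - eexp t‖ ≤ 2 * Real.pi * |s - t| := by
  have h : eexp s - eexp t = eexp t * (eexp (s - t) - 1) := by
    rw [mul_sub, ← eexp_add, mul_one]
    ring_nf
  rw [h, norm_mul, norm_eexp, one_mul, eexp,
    show (2 * Real.pi * Complex.I * ((s - t : ℝ) : ℂ) : ℂ)
      = Complex.I * ((2 * Real.pi * (s - t) : ℝ) : ℂ) by push_cast; ring]
  refine Real.norm_exp_I_mul_ofReal_sub_one_le.trans ?_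
  rw [Real.norm_eq_abs, abs_mul, abs_of_pos Real.two_pi_pos]

theorem floor_div_eq_iff_mem_Ico {ι : Type*} {s : ι → ℝ} (hs : ∀ i, 0 < s i) (k : ι → ℤ)
    (t : ι → ℝ) :
    (fun i => ⌊t i / s i⌋) = k ↔
      t ∈ Set.pi Set.univ fun i => Set.Ico (s i * k i) (s i * (k i + 1)) := by
  simp only [funext_iff, Int.floor_eq_iff, Set.mem_univ_pi, Set.mem_Ico, le_div_iff₀ (hs _),
    div_lt_iff₀ (hs _), mul_comm (s _)]

section Grid

variable {ι : Type*} [Fintype ι]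

/-- The integral of a finitely supported function of the grid cell is the cell volume times
the sum over all cells. -/
theorem integral_comp_floor_div {s : ι → ℝ} (hs : ∀ i, 0 < s i) {g : (ι → ℤ) → ℂ}
    (hg : g.support.Finite) :
    Integrable (fun t : ι → ℝ => g fun i => ⌊t i / s i⌋) ∧
      ∫ t : ι → ℝ, g (fun i => ⌊t i / s i⌋) = ((∏ i, s i : ℝ) : ℂ) * ∑' k, g k := by
  set A : (ι → ℤ) → Set (ι → ℝ) := fun k =>
    Set.pi Set.univ fun i => Set.Ico (s i * k i) (s i * (k i + 1)) with hA
  have hmeas : ∀ k, MeasurableSet (A k) := fun k =>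
    MeasurableSet.univ_pi fun i => measurableSet_Ico
  have hvol : ∀ k, volume (A k) = ENNReal.ofReal (∏ i, s i) := fun k => by
    rw [hA, Real.volume_pi_Ico, ENNReal.ofReal_prod_of_nonneg fun i _ => (hs i).le]
    refine Finset.prod_congr rfl fun i _ => ?_
    ring_nf
  have key : (fun t : ι → ℝ => g fun i => ⌊t i / s i⌋) =
      fun t => ∑ k ∈ hg.toFinset, (A k).indicator (fun _ => g k) t := by
    funext t
    set k₀ : ι → ℤ := fun i => ⌊t i / s i⌋ with hk₀
    have h1 : ∀ k, (A k).indicator (fun _ => g k) t = if k = k₀ then g k else 0 := fun k => by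
      rw [Set.indicator_apply]
      refine if_congr ?_ rfl rfl
      rw [hA, ← floor_div_eq_iff_mem_Ico hs k t, eq_comm]
    simp only [h1, Finset.sum_ite_eq', Set.Finite.mem_toFinset, Function.mem_support]
    split_ifs with h
    · rfl
    · simpa using h
  have hint : ∀ k, Integrable ((A k).indicator fun _ => g k) := fun k =>
    (integrable_indicator_iff (hmeas k)).2 <| integrableOn_const (by rw [hvol]; simp)
  rw [key]
  refine ⟨integrable_finsetSum _ fun k _ => hint k, ?_⟩
  rw [integral_finsetSum _ fun k _ => hint k, tsum_eq_sum (s := hg.toFinset), Finset.mul_sum]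
  · refine Finset.sum_congr rfl fun k _ => ?_
    rw [integral_indicator_const _ (hmeas k), measureReal_def, hvol,
      ENNReal.toReal_ofReal (Finset.prod_nonneg fun i _ => (hs i).le), Complex.real_smul]
  · intro k hk
    simpa using hk

theorem volume_closedBall_two :
    volume (Metric.closedBall (0 : ι → ℝ) 2) = 4 ^ Fintype.card ι := by
  rw [Real.volume_pi_closedBall _ (by norm_num), ENNReal.ofReal_pow (by norm_num)]
  norm_num

theorem finite_setOf_norm_grid_le {s : ι → ℝ} (hs : ∀ i, 0 < s i) (c : ι → ℝ) :
    {k : ι → ℤ | ‖fun i => s i * (k i + c i)‖ ≤ 1}.Finite := by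
  refine (Set.finite_Icc (fun i => ⌊-1 / s i - c i⌋) fun i => ⌈1 / s i - c i⌉).subset ?_
  intro k hk
  rw [Set.mem_ofPred_eq, pi_norm_le_iff_of_nonneg zero_le_one] at hk
  have h := fun i => abs_le.1 (hk i)
  refine ⟨fun i => ?_, fun i => ?_⟩
  · have := (h i).1
    rw [← div_le_iff₀' (hs i)] at this
    rw [← Int.cast_le (R := ℝ)]
    exact (Int.floor_le _).trans (by linarith)
  · have := (h i).2
    rw [← le_div_iff₀' (hs i)] at this
    rw [← Int.cast_le (R := ℝ)]
    exact le_trans (by linarith) (Int.le_ceil (1 / s i - c i))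

/-- The volume of the points of a box near a symmetric pair of graphs over a coordinate
hyperplane. -/
theorem volume_near_graph_le [DecidableEq ι] (i : ι) {φ : (ι → ℝ) → ℝ} (hφ : Continuous φ)
    (hφi : ∀ t x, φ (Function.update t i x) = φ t) {δ : ℝ} (hδ : 0 ≤ δ) :
    volume {t : ι → ℝ | t ∈ Metric.closedBall 0 2 ∧ |(|t i| - φ t)| ≤ 2 * δ} ≤
      ENNReal.ofReal (2 * δ) * 4 ^ Fintype.card ι := by
  set S := {t : ι → ℝ | t ∈ Metric.closedBall 0 2 ∧ |(|t i| - φ t)| ≤ 2 * δ} with hS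
  have hSm : MeasurableSet S := by
    have h : Continuous fun t : ι → ℝ => |(|t i| - φ t)| := by fun_prop
    exact (Metric.isClosed_closedBall.inter (isClosed_le h continuous_const)).measurableSet
  have hBm : MeasurableSet (Metric.closedBall (0 : ι → ℝ) 2) := measurableSet_closedBall
  have h1 : Measurable (S.indicator (1 : (ι → ℝ) → ℝ≥0∞)) := measurable_one.indicator hSm
  have h2 : Measurable
      ((Metric.closedBall (0 : ι → ℝ) 2).indicator fun _ => ENNReal.ofReal (2 * δ)) :=
    measurable_const.indicator hBm
  rw [← volume_closedBall_two, ← lintegral_indicator_one hSm, ← lintegral_indicator_const hBm]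
  rw [volume_pi, lintegral_eq_lmarginal_univ (0 : ι → ℝ), lintegral_eq_lmarginal_univ (0 : ι → ℝ),
    lmarginal_erase' _ h1 (Finset.mem_univ i), lmarginal_erase' _ h2 (Finset.mem_univ i)]
  refine lmarginal_mono (fun t => ?_) _
  by_cases ht : ∀ j, j ≠ i → |t j| ≤ 2
  · have hb : ∀ x, Function.update t i x ∈ Metric.closedBall (0 : ι → ℝ) 2 ↔
        x ∈ Set.Icc (-2 : ℝ) 2 := fun x => by
      rw [mem_closedBall_zero_iff, pi_norm_le_iff_of_nonneg zero_le_two, Set.mem_Icc, ← abs_le]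
      refine ⟨fun h => by simpa using h i, fun h j => ?_⟩
      by_cases hj : j = i
      · subst hj; simpa using h
      · simpa [hj] using ht j hj
    have e2 : ∀ x, (Metric.closedBall (0 : ι → ℝ) 2).indicator
        (fun _ => ENNReal.ofReal (2 * δ)) (Function.update t i x) =
        (Set.Icc (-2 : ℝ) 2).indicator (fun _ => ENNReal.ofReal (2 * δ)) x := fun x => by
      simp only [Set.indicator_apply, hb]
    simp only [e2]
    rw [lintegral_indicator_const measurableSet_Icc, Real.volume_Icc]
    calc ∫⁻ x, S.indicator 1 (Function.update t i x)
        ≤ ∫⁻ x, (Set.Icc (φ t - 2 * δ) (φ t + 2 * δ) ∪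
            Set.Icc (-φ t - 2 * δ) (-φ t + 2 * δ)).indicator 1 x := by
          refine lintegral_mono fun x => ?_
          simp only [Set.indicator_apply]
          split_ifs with h h' h'
          · exact le_rfl
          · refine absurd ?_ h'
            have := h.2
            simp only [Function.update_self, hφi] at this
            rw [abs_le] at this
            rcases abs_cases x with hx | hx
            · left; constructor <;> linarith
            · right; constructor <;> linarith
          · exact zero_le
          · exact le_rfl
      _ ≤ ENNReal.ofReal (4 * δ) + ENNReal.ofReal (4 * δ) := by
          rw [lintegral_indicator_one (measurableSet_Icc.union measurableSet_Icc)]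
          refine (measure_union_le _ _).trans ?_
          rw [Real.volume_Icc, Real.volume_Icc]
          ring_nf
          exact le_rfl
      _ = ENNReal.ofReal (2 * δ) * ENNReal.ofReal (2 - -2) := by
          rw [← ENNReal.ofReal_add (by positivity) (by positivity),
            ← ENNReal.ofReal_mul (by positivity)]
          ring_nf
  · have : ∀ x, S.indicator (1 : (ι → ℝ) → ℝ≥0∞) (Function.update t i x) = 0 := fun x => by
      refine Set.indicator_of_notMem (fun h => ht fun j hj => ?_) _
      have := h.1
      rw [mem_closedBall_zero_iff, pi_norm_le_iff_of_nonneg zero_le_two] at this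
      simpa [hj] using this j
    simp [this]

theorem norm_integral_le_of_support_subset {g : (ι → ℝ) → ℂ} (hg : ∀ t, ‖g t‖ ≤ 1)
    (hgs : ∀ t, g t ≠ 0 → ‖t‖ ≤ 2) : ‖∫ t, g t‖ ≤ 4 ^ Fintype.card ι := by
  have h : ‖∫ t, g t‖ₑ ≤ ENNReal.ofReal (4 ^ Fintype.card ι) := by
    calc _ ≤ ∫⁻ t, ‖g t‖ₑ := enorm_integral_le_lintegral_enorm _
      _ ≤ ∫⁻ t, (Metric.closedBall (0 : ι → ℝ) 2).indicator 1 t := by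
          refine lintegral_mono fun t => ?_
          by_cases ht : g t = 0
          · simp [ht]
          · rw [Set.indicator_of_mem (by simpa using hgs t ht), ← ofReal_norm]
            exact ENNReal.ofReal_le_one.2 (hg t)
      _ = _ := by
          rw [lintegral_indicator_one measurableSet_closedBall, volume_closedBall_two,
            ENNReal.ofReal_pow (by norm_num)]
          norm_num
  rw [← ofReal_norm] at h
  exact (ENNReal.ofReal_le_ofReal_iff (by positivity)).1 h

/-- Comparison of a grid sum with an integral over a region bounded by Lipschitz graphs. -/
theorem norm_grid_sum_sub_integral_le {φ : ι → (ι → ℝ) → ℝ} (hφ : ∀ i, LipschitzWith 1 (φ i))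
    (hφi : ∀ i t x, φ i (Function.update t i x) = φ i t) {D : Set (ι → ℝ)}
    (hDφ : ∀ t, t ∈ D ↔ ∀ i, |t i| ≤ φ i t) (hD : D ⊆ Metric.closedBall 0 1)
    {f : (ι → ℝ) → ℂ} (hf : Continuous f) (hf1 : ∀ t, ‖f t‖ ≤ 1) {M : ℝ} (hM : 0 ≤ M)
    (hfL : ∀ t ∈ D, ∀ t' ∈ D, ‖f t - f t'‖ ≤ M * ‖t - t'‖) {δ : ℝ} (hδ0 : 0 ≤ δ) (hδ1 : δ ≤ 1)
    {s : ι → ℝ} (hs : ∀ i, 0 < s i) (hsδ : ∀ i, s i ≤ δ) {c : ι → ℝ}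
    (hc0 : ∀ i, 0 ≤ c i) (hc1 : ∀ i, c i ≤ 1) :
    ‖((∏ i, s i : ℝ) : ℂ) * ∑' k : ι → ℤ, D.indicator f (fun i => s i * (k i + c i)) -
        ∫ t, D.indicator f t‖ ≤
      4 ^ Fintype.card ι * δ * (M + 2 * Fintype.card ι) := by
  have hDm : MeasurableSet D := by
    have : D = ⋂ i, {t | |t i| ≤ φ i t} := by ext t; simp [hDφ]
    rw [this]
    refine MeasurableSet.iInter fun i => (isClosed_le ?_ (hφ i).continuous).measurableSet
    fun_prop
  have hBm : MeasurableSet (Metric.closedBall (0 : ι → ℝ) 2) := measurableSet_closedBall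
  have hDfin : volume D < ⊤ :=
    (measure_mono hD).trans_lt Metric.isBounded_closedBall.measure_lt_top
  set τ : (ι → ℝ) → ι → ℝ := fun t i => s i * (⌊t i / s i⌋ + c i) with hτ
  have hτt : ∀ t, ‖τ t - t‖ ≤ δ := fun t => by
    rw [pi_norm_le_iff_of_nonneg hδ0]
    intro i
    refine le_trans ?_ (hsδ i)
    have h1 : t i = s i * (⌊t i / s i⌋ + Int.fract (t i / s i)) := by
      rw [Int.floor_add_fract, mul_div_cancel₀ _ (hs i).ne']
    have h2 : (τ t - t) i = s i * (c i - Int.fract (t i / s i)) := by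
      rw [Pi.sub_apply]
      have h3 : τ t i = s i * (⌊t i / s i⌋ + c i) := rfl
      linear_combination h3 - h1
    rw [h2, Real.norm_eq_abs, abs_mul, abs_of_pos (hs i)]
    refine mul_le_of_le_one_right (hs i).le (abs_le.2 ⟨?_, ?_⟩)
    · linarith [hc0 i, Int.fract_lt_one (t i / s i)]
    · linarith [hc1 i, Int.fract_nonneg (t i / s i)]
  have hsupp : (fun k : ι → ℤ => D.indicator f (fun i => s i * (k i + c i))).support.Finite := by
    refine (finite_setOf_norm_grid_le hs c).subset fun k hk => ?_
    have := hD (Set.mem_of_indicator_ne_zero hk)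
    simpa using this
  obtain ⟨hint, hsum⟩ := integral_comp_floor_div hs hsupp
  have hintD : Integrable (D.indicator f) := by
    rw [integrable_indicator_iff hDm]
    exact Measure.integrableOn_of_bounded hDfin.ne hf.aestronglyMeasurable
      (Filter.Eventually.of_forall hf1)
  rw [← hsum, ← integral_sub hint hintD]
  change ‖∫ t, (D.indicator f (τ t) - D.indicator f t)‖ ≤ _
  set S : ι → Set (ι → ℝ) := fun i =>
    {t | t ∈ Metric.closedBall 0 2 ∧ |(|t i| - φ i t)| ≤ 2 * δ} with hS
  have hbad : ∀ t t', ‖t - t'‖ ≤ δ → t ∈ D → t' ∉ D → t ∈ (⋃ i, S i) ∧ t' ∈ ⋃ i, S i := by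
    intro t t' htt ht ht'
    have ht1 : ‖t‖ ≤ 1 := by simpa using hD ht
    have ht'2 : ‖t'‖ ≤ 2 := by
      have := norm_sub_norm_le t' t
      rw [norm_sub_rev] at this
      linarith
    rw [hDφ] at ht'
    push Not at ht'
    obtain ⟨i, hi⟩ := ht'
    have h1 := (hDφ t).1 ht i
    have h2 : |φ i t - φ i t'| ≤ δ := by
      have := (hφ i).norm_sub_le t t'
      simp only [NNReal.coe_one, one_mul, Real.norm_eq_abs] at this
      exact this.trans htt
    have h3 : |(|t i| - |t' i|)| ≤ δ :=
      (abs_abs_sub_abs_le_abs_sub _ _).trans ((norm_le_pi_norm (t - t') i).trans htt)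
    rw [abs_le] at h2 h3
    refine ⟨Set.mem_iUnion.2 ⟨i, ?_, ?_⟩, Set.mem_iUnion.2 ⟨i, ?_, ?_⟩⟩
    · rw [mem_closedBall_zero_iff]; linarith
    · rw [abs_le]; constructor <;> linarith
    · rw [mem_closedBall_zero_iff]; linarith
    · rw [abs_le]; constructor <;> linarith
  have hpt : ∀ t, ‖D.indicator f (τ t) - D.indicator f t‖ₑ ≤
      (Metric.closedBall (0 : ι → ℝ) 2).indicator (fun _ => ENNReal.ofReal (M * δ)) t +
        (⋃ i, S i).indicator 1 t := by
    intro t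
    by_cases h1 : τ t ∈ D <;> by_cases h2 : t ∈ D
    · refine le_add_right ?_
      have h2' : t ∈ Metric.closedBall (0 : ι → ℝ) 2 :=
        Metric.closedBall_subset_closedBall one_le_two (hD h2)
      rw [Set.indicator_of_mem h1, Set.indicator_of_mem h2, Set.indicator_of_mem h2',
        ← ofReal_norm]
      refine ENNReal.ofReal_le_ofReal ((hfL _ h1 _ h2).trans ?_)
      exact mul_le_mul_of_nonneg_left (hτt t) hM
    · refine le_add_left ?_
      rw [Set.indicator_of_mem h1, Set.indicator_of_notMem h2, sub_zero,
        Set.indicator_of_mem (hbad _ _ (hτt t) h1 h2).2, ← ofReal_norm]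
      exact ENNReal.ofReal_le_one.2 (hf1 _)
    · refine le_add_left ?_
      have h3 : ‖t - τ t‖ ≤ δ := by rw [norm_sub_rev]; exact hτt t
      rw [Set.indicator_of_mem h2, Set.indicator_of_notMem h1, zero_sub, enorm_neg,
        Set.indicator_of_mem (hbad _ _ h3 h2 h1).1, ← ofReal_norm]
      exact ENNReal.ofReal_le_one.2 (hf1 _)
    · rw [Set.indicator_of_notMem h2, Set.indicator_of_notMem h1]
      simp
  have hfinal : ‖∫ t, (D.indicator f (τ t) - D.indicator f t)‖ₑ ≤
      ENNReal.ofReal (4 ^ Fintype.card ι * δ * (M + 2 * Fintype.card ι)) := by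
    calc _ ≤ ∫⁻ t, ‖D.indicator f (τ t) - D.indicator f t‖ₑ := enorm_integral_le_lintegral_enorm _
      _ ≤ ∫⁻ t, ((Metric.closedBall (0 : ι → ℝ) 2).indicator
            (fun _ => ENNReal.ofReal (M * δ)) t + (⋃ i, S i).indicator 1 t) := lintegral_mono hpt
      _ ≤ ENNReal.ofReal (M * δ) * 4 ^ Fintype.card ι +
            ∑ _i : ι, ENNReal.ofReal (2 * δ) * 4 ^ Fintype.card ι := by
          rw [lintegral_add_left (measurable_const.indicator hBm),
            lintegral_indicator_const hBm, volume_closedBall_two]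
          gcongr
          refine (lintegral_indicator_one_le _).trans ?_
          refine (measure_iUnion_fintype_le _ _).trans (Finset.sum_le_sum fun i _ => ?_)
          exact volume_near_graph_le i (hφ i).continuous (hφi i) hδ0
      _ = _ := by
          rw [Finset.sum_const, Finset.card_univ, nsmul_eq_mul]
          have e4 : (4 : ℝ≥0∞) ^ Fintype.card ι = ENNReal.ofReal (4 ^ Fintype.card ι) := by
            rw [ENNReal.ofReal_pow (by norm_num)]; norm_num
          have eN : (Fintype.card ι : ℝ≥0∞) = ENNReal.ofReal (Fintype.card ι) := by simp
          rw [e4, eN, ← ENNReal.ofReal_mul (by positivity), ← ENNReal.ofReal_mul (by positivity),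
            ← ENNReal.ofReal_mul (by positivity), ← ENNReal.ofReal_add (by positivity)
            (by positivity)]
          congr 1
          ring
  rw [← ofReal_norm] at hfinal
  exact (ENNReal.ofReal_le_ofReal_iff (by positivity)).1 hfinal

/-- Integer vectors decomposed into residues and quotients modulo `q`. -/
def intPiEquivResidueProd (ι : Type*) (q : ℕ) [NeZero q] :
    (ι → ZMod q) × (ι → ℤ) ≃ (ι → ℤ) where
  toFun p i := q * p.2 i + (p.1 i).val
  invFun k := (fun i => (k i : ZMod q), fun i => k i / q)
  left_inv p := by
    have hq : (q : ℤ) ≠ 0 := by exact_mod_cast NeZero.ne q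
    refine Prod.ext (funext fun i => ?_) (funext fun i => ?_)
    · simp
    · have h0 : ((p.1 i).val : ℤ) / q = 0 :=
        Int.ediv_eq_zero_of_lt (by positivity) (by exact_mod_cast ZMod.val_lt _)
      simp only []
      rw [Int.add_comm, Int.add_mul_ediv_left _ _ hq, h0, zero_add]
  right_inv k := by
    funext i
    simp only [ZMod.val_intCast]
    exact Int.mul_ediv_add_emod _ _

theorem tsum_int_pi_eq_sum_residues (q : ℕ) [NeZero q] {f : (ι → ℤ) → ℂ}
    (hf : f.support.Finite) :
    ∑' k, f k = ∑ b : ι → ZMod q, ∑' k : ι → ℤ, f fun i => q * k i + (b i).val := by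
  rw [← (intPiEquivResidueProd ι q).tsum_eq f, Summable.tsum_prod, tsum_fintype]
  · rfl
  · exact (intPiEquivResidueProd ι q).summable_iff.2 (summable_of_hasFiniteSupport hf)

/-- Comparison of a lattice sum with periodic weights modulo `q` with its expected value. -/
theorem norm_weighted_sum_sub_le {φ : ι → (ι → ℝ) → ℝ} (hφ : ∀ i, LipschitzWith 1 (φ i))
    (hφi : ∀ i t x, φ i (Function.update t i x) = φ i t) {D : Set (ι → ℝ)}
    (hDφ : ∀ t, t ∈ D ↔ ∀ i, |t i| ≤ φ i t) (hD : D ⊆ Metric.closedBall 0 1)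
    {f : (ι → ℝ) → ℂ} (hf : Continuous f) (hf1 : ∀ t, ‖f t‖ ≤ 1) {M : ℝ} (hM : 0 ≤ M)
    (hfL : ∀ t ∈ D, ∀ t' ∈ D, ‖f t - f t'‖ ≤ M * ‖t - t'‖) {q : ℕ} [NeZero q]
    {w : (ι → ZMod q) → ℂ} (hw : ∀ b, ‖w b‖ ≤ 1) {P : ℝ} (hP : 1 ≤ P) {σ : ι → ℝ}
    (hσ : ∀ i, P ≤ σ i) :
    ‖∑' k : ι → ℤ, w (fun i => (k i : ZMod q)) * D.indicator f (fun i => k i / σ i) -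
        ((∏ i, σ i : ℝ) : ℂ) * ((q : ℂ) ^ Fintype.card ι)⁻¹ * (∑ b, w b) *
          ∫ t, D.indicator f t‖ ≤
      (∏ i, σ i) * (4 ^ Fintype.card ι * (q / P) * (M + 2 * Fintype.card ι + 2)) := by
  have hP0 : 0 < P := by linarith
  have hσ0 : ∀ i, 0 < σ i := fun i => hP0.trans_le (hσ i)
  have hprod : 0 < ∏ i, σ i := Finset.prod_pos fun i _ => hσ0 i
  have hq0 : 0 < (q : ℝ) := by exact_mod_cast NeZero.pos q
  have hqc : (q : ℂ) ≠ 0 := by exact_mod_cast NeZero.ne q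
  have hG1 : ∀ t, ‖D.indicator f t‖ ≤ 1 := fun t =>
    (norm_indicator_le_norm_self _ _).trans (hf1 t)
  have hGs : ∀ t, D.indicator f t ≠ 0 → ‖t‖ ≤ 1 := fun t ht => by
    simpa using hD (Set.mem_of_indicator_ne_zero ht)
  have hfin : {k : ι → ℤ | ‖fun i => (k i : ℝ) / σ i‖ ≤ 1}.Finite := by
    have := finite_setOf_norm_grid_le (s := fun i => (σ i)⁻¹) (fun i => inv_pos.2 (hσ0 i))
      (fun _ => 0)
    simpa only [add_zero, inv_mul_eq_div] using this
  have hsupp : (fun k : ι → ℤ => w (fun i => (k i : ZMod q)) *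
      D.indicator f (fun i => k i / σ i)).support.Finite :=
    hfin.subset fun k hk => hGs _ (right_ne_zero_of_mul hk)
  rcases le_or_gt (q : ℝ) P with hqP | hqP
  · have hdiff : ∀ b : ι → ZMod q,
        ‖∑' k : ι → ℤ, D.indicator f (fun i => ((q * k i + (b i).val : ℤ) : ℝ) / σ i) -
          ((∏ i, σ i : ℝ) : ℂ) * ((q : ℂ) ^ Fintype.card ι)⁻¹ * ∫ t, D.indicator f t‖ ≤
        (∏ i, σ i) * ((q : ℝ) ^ Fintype.card ι)⁻¹ *
          (4 ^ Fintype.card ι * (q / P) * (M + 2 * Fintype.card ι)) := by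
      intro b
      have key := norm_grid_sum_sub_integral_le hφ hφi hDφ hD hf hf1 hM hfL (δ := q / P)
        (by positivity) ((div_le_one hP0).2 hqP) (s := fun i => q / σ i)
        (fun i => div_pos hq0 (hσ0 i)) (fun i => div_le_div_of_nonneg_left hq0.le hP0 (hσ i))
        (c := fun i => (b i).val / q) (fun i => by positivity)
        (fun i => (div_le_one hq0).2 (by exact_mod_cast (ZMod.val_lt (b i)).le))
      have e1 : ∀ k : ι → ℤ, (fun i => (q / σ i : ℝ) * (k i + (b i).val / q)) =
          fun i => ((q * k i + (b i).val : ℤ) : ℝ) / σ i := fun k => by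
        funext i
        have := (hσ0 i).ne'
        push_cast
        field_simp
      simp only [e1] at key
      rw [Finset.prod_div_distrib, Finset.prod_const, Finset.card_univ] at key
      set X := ∑' k : ι → ℤ, D.indicator f (fun i => ((q * k i + (b i).val : ℤ) : ℝ) / σ i)
      set Y := ∫ t, D.indicator f t
      set C : ℝ := (∏ i, σ i) * ((q : ℝ) ^ Fintype.card ι)⁻¹ with hC
      have hC0 : 0 < C := by positivity
      have e2 : X - ((∏ i, σ i : ℝ) : ℂ) * ((q : ℂ) ^ Fintype.card ι)⁻¹ * Y =
          (C : ℂ) * (((q ^ Fintype.card ι / ∏ i, σ i : ℝ) : ℂ) * X - Y) := by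
        have hprodc : ((∏ i, σ i : ℝ) : ℂ) ≠ 0 := by exact_mod_cast hprod.ne'
        rw [hC]
        push_cast at hprodc ⊢
        field_simp
      rw [e2, norm_mul, Complex.norm_real, Real.norm_eq_abs, abs_of_pos hC0]
      exact mul_le_mul_of_nonneg_left key hC0.le
    rw [tsum_int_pi_eq_sum_residues q hsupp]
    have e3 : ∀ (b : ι → ZMod q) (k : ι → ℤ),
        (fun i => ((q * k i + (b i).val : ℤ) : ZMod q)) = b := fun b k => by
      funext i; simp
    simp only [e3, tsum_mul_left]
    rw [mul_right_comm, Finset.mul_sum, ← Finset.sum_sub_distrib]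
    calc _ ≤ ∑ b : ι → ZMod q, (∏ i, σ i) * ((q : ℝ) ^ Fintype.card ι)⁻¹ *
          (4 ^ Fintype.card ι * (q / P) * (M + 2 * Fintype.card ι)) := by
            refine norm_sum_le_of_le _ fun b _ => ?_
            rw [mul_comm _ (w b), ← mul_sub, norm_mul]
            exact (mul_le_of_le_one_left (norm_nonneg _) (hw b)).trans (hdiff b)
      _ = (∏ i, σ i) * (4 ^ Fintype.card ι * (q / P) * (M + 2 * Fintype.card ι)) := by
            rw [Finset.sum_const, Finset.card_univ, Fintype.card_fun, ZMod.card, nsmul_eq_mul]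
            push_cast
            field_simp
      _ ≤ _ := by
            exact mul_le_mul_of_nonneg_left
              (mul_le_mul_of_nonneg_left (by linarith) (by positivity)) hprod.le
  · have hcount : ‖∑' k : ι → ℤ, w (fun i => (k i : ZMod q)) *
        D.indicator f (fun i => k i / σ i)‖ ≤ (∏ i, σ i) * 4 ^ Fintype.card ι := by
      have hσi : ∀ i, 0 < (σ i)⁻¹ := fun i => inv_pos.2 (hσ0 i)
      obtain ⟨-, hsum⟩ := integral_comp_floor_div hσi hsupp
      have hle := norm_integral_le_of_support_subset (g := fun t : ι → ℝ =>
        w (fun i => (⌊t i / (σ i)⁻¹⌋ : ZMod q)) *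
          D.indicator f (fun i => ⌊t i / (σ i)⁻¹⌋ / σ i))
        (fun t => by
          rw [norm_mul]
          exact mul_le_one₀ (hw _) (norm_nonneg _) (hG1 _))
        (fun t ht => by
          have h1 := hGs _ (right_ne_zero_of_mul ht)
          rw [pi_norm_le_iff_of_nonneg zero_le_one] at h1
          rw [pi_norm_le_iff_of_nonneg zero_le_two]
          intro i
          have h2 := abs_le.1 (h1 i)
          rw [div_inv_eq_mul, le_div_iff₀ (hσ0 i), div_le_iff₀ (hσ0 i)] at h2
          have h3 := Int.floor_le (t i * σ i)
          have h4 := Int.lt_floor_add_one (t i * σ i)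
          have h5 : 1 ≤ σ i := hP.trans (hσ i)
          rw [Real.norm_eq_abs, abs_le]
          constructor <;> by_contra! h6 <;> nlinarith [h2.1, h2.2, hσ0 i])
      rw [hsum, norm_mul, Complex.norm_real, Real.norm_eq_abs, Finset.prod_inv_distrib,
        abs_of_pos (inv_pos.2 hprod), inv_mul_le_iff₀ hprod] at hle
      exact hle
    have hint : ‖∫ t, D.indicator f t‖ ≤ 4 ^ Fintype.card ι :=
      norm_integral_le_of_support_subset hG1 fun t ht => (hGs t ht).trans one_le_two
    have hmain : ‖((∏ i, σ i : ℝ) : ℂ) * ((q : ℂ) ^ Fintype.card ι)⁻¹ * (∑ b, w b) *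
          ∫ t, D.indicator f t‖ ≤ (∏ i, σ i) * 4 ^ Fintype.card ι := by
      have hwsum : ‖∑ b, w b‖ ≤ (q : ℝ) ^ Fintype.card ι := by
        refine (norm_sum_le_of_le _ fun b _ => hw b).trans ?_
        simp [ZMod.card]
      rw [norm_mul, norm_mul, norm_mul, norm_inv, norm_pow, Complex.norm_natCast,
        Complex.norm_real, Real.norm_eq_abs, abs_of_pos hprod]
      calc _ ≤ (∏ i, σ i) * ((q : ℝ) ^ Fintype.card ι)⁻¹ * (q : ℝ) ^ Fintype.card ι *
            4 ^ Fintype.card ι := by gcongr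
        _ = _ := by field_simp
    have h1 : 1 ≤ q / P := (one_le_div hP0).2 hqP.le
    calc _ ≤ (∏ i, σ i) * 4 ^ Fintype.card ι + (∏ i, σ i) * 4 ^ Fintype.card ι :=
          (norm_sub_le _ _).trans (add_le_add hcount hmain)
      _ = (∏ i, σ i) * (4 ^ Fintype.card ι * 1 * 2) := by ring
      _ ≤ _ := by
          gcongr
          have : (0 : ℝ) ≤ Fintype.card ι := by positivity
          linarith

end Grid

theorem exists_lipschitz_on_unit_ball {ι : Type*} [Fintype ι] (p : MvPolynomial ι ℤ) :
    ∃ L : ℝ, 0 ≤ L ∧ ∀ t t' : ι → ℝ, ‖t‖ ≤ 1 → ‖t'‖ ≤ 1 →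
      |aeval t p - aeval t' p| ≤ L * ‖t - t'‖ := by
  suffices h : ∃ L B : ℝ, 0 ≤ L ∧ 0 ≤ B ∧ ∀ t t' : ι → ℝ, ‖t‖ ≤ 1 → ‖t'‖ ≤ 1 →
      |aeval t p| ≤ B ∧ |aeval t p - aeval t' p| ≤ L * ‖t - t'‖ by
    obtain ⟨L, B, hL, -, h⟩ := h
    exact ⟨L, hL, fun t t' ht ht' => (h t t' ht ht').2⟩
  induction p using MvPolynomial.induction_on with
  | C a => exact ⟨0, |(a : ℝ)|, le_rfl, abs_nonneg _, fun t t' _ _ => by simp⟩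
  | add p p' ih ih' =>
    obtain ⟨L, B, hL, hB, h⟩ := ih
    obtain ⟨L', B', hL', hB', h'⟩ := ih'
    refine ⟨L + L', B + B', by positivity, by positivity, fun t t' ht ht' => ⟨?_, ?_⟩⟩
    · rw [map_add]
      exact (abs_add_le _ _).trans (add_le_add (h t t' ht ht').1 (h' t t' ht ht').1)
    · rw [map_add, map_add, add_sub_add_comm, add_mul]
      exact (abs_add_le _ _).trans (add_le_add (h t t' ht ht').2 (h' t t' ht ht').2)
  | mul_X p i ih =>
    obtain ⟨L, B, hL, hB, h⟩ := ih
    refine ⟨L + B, B, by positivity, hB, fun t t' ht ht' => ⟨?_, ?_⟩⟩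
    · rw [map_mul, aeval_X, abs_mul]
      exact (mul_le_of_le_one_right (abs_nonneg _) ((norm_le_pi_norm t i).trans ht)).trans
        (h t t' ht ht').1
    · have e : aeval t (p * X i) - aeval t' (p * X i) =
          (aeval t p - aeval t' p) * t i + aeval t' p * (t - t') i := by
        simp only [map_mul, aeval_X, Pi.sub_apply]; ring
      rw [e, add_mul]
      refine (abs_add_le _ _).trans (add_le_add ?_ ?_)
      · rw [abs_mul]
        exact (mul_le_of_le_one_right (abs_nonneg _) ((norm_le_pi_norm t i).trans ht)).trans
          (h t t' ht ht').2
      · rw [abs_mul]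
        exact mul_le_mul (h t' t ht' ht).1 (norm_le_pi_norm (t - t') i) (abs_nonneg _) hB

section Bihomogeneous


/-- The bounds `|uᵢ| ≤ 1`, `|vⱼ| ≤ |𝐮|`, `|wₖ| ≤ 1` that cut out the region of `Ibeta`. -/
def coordBound (n m r : ℕ) : Idx n m r → (Idx n m r → ℝ) → ℝ :=
  Sum.elim (fun _ _ => 1) (Sum.elim (fun _ t => ‖fun i => t (Sum.inl i)‖) fun _ _ => 1)

/-- The integration region of `Ibeta`, in flat coordinates. -/
def coordRegion (n m r : ℕ) : Set (Idx n m r → ℝ) := {t | ∀ i, |t i| ≤ coordBound n m r i t}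

theorem lipschitzWith_coordBound (i : Idx n m r) : LipschitzWith 1 (coordBound n m r i) := by
  rcases i with i | j | k
  · exact LipschitzWith.const' 1
  · refine LipschitzWith.of_dist_le_mul fun t t' => ?_
    rw [NNReal.coe_one, one_mul]
    refine (dist_norm_norm_le _ _).trans ?_
    rw [dist_eq_norm, pi_norm_le_iff_of_nonneg (norm_nonneg _)]
    exact fun i => norm_le_pi_norm (t - t') (Sum.inl i)
  · exact LipschitzWith.const' 1

theorem coordBound_update (i : Idx n m r) (t : Idx n m r → ℝ) (x : ℝ) :
    coordBound n m r i (Function.update t i x) = coordBound n m r i t := by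
  rcases i with i | j | k <;> simp [coordBound]

theorem mem_coordRegion_iff (t : Idx n m r → ℝ) :
    t ∈ coordRegion n m r ↔ ‖fun i => t (Sum.inl i)‖ ≤ 1 ∧
      ‖fun j => t (Sum.inr (Sum.inl j))‖ ≤ ‖fun i => t (Sum.inl i)‖ ∧
      ‖fun k => t (Sum.inr (Sum.inr k))‖ ≤ 1 := by
  rw [pi_norm_le_iff_of_nonneg zero_le_one, pi_norm_le_iff_of_nonneg (norm_nonneg _),
    pi_norm_le_iff_of_nonneg zero_le_one]
  simp only [coordRegion, coordBound, Set.mem_ofPred_eq, Sum.forall, Sum.elim_inl, Sum.elim_inr,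
    Real.norm_eq_abs]

theorem coordRegion_subset : coordRegion n m r ⊆ Metric.closedBall 0 1 := by
  intro t ht
  obtain ⟨h1, h2, h3⟩ := (mem_coordRegion_iff t).1 ht
  rw [mem_closedBall_zero_iff, pi_norm_le_iff_of_nonneg zero_le_one]
  rintro (i | j | k)
  · exact (norm_le_pi_norm (fun i => t (Sum.inl i)) i).trans h1
  · exact (norm_le_pi_norm (fun j => t (Sum.inr (Sum.inl j))) j).trans (h2.trans h1)
  · exact (norm_le_pi_norm (fun k => t (Sum.inr (Sum.inr k))) k).trans h3

/-- Flat vectors as triples of vectors. -/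
def splitEquiv (n m r : ℕ) (R : Type*) :
    (Idx n m r → R) ≃ (Fin (r + 1) → R) × (Fin (m - r) → R) × (Fin (n - m + 1) → R) :=
  (Equiv.sumArrowEquivProdArrow _ _ R).trans
    ((Equiv.refl _).prodCongr (Equiv.sumArrowEquivProdArrow _ _ R))

theorem evalF_eq_aeval {R : Type} [CommRing R] (F : MvPolynomial (Idx n m r) ℤ)
    (t : Idx n m r → R) :
    evalF F (fun i => t (Sum.inl i)) (fun j => t (Sum.inr (Sum.inl j)))
      (fun k => t (Sum.inr (Sum.inr k))) = aeval t F := by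
  rw [evalF]
  congr 2
  funext i
  rcases i with i | j | k <;> rfl

theorem map_evalF {R S : Type} [CommRing R] [CommRing S] (g : R →+* S)
    (F : MvPolynomial (Idx n m r) ℤ) (x : Fin (r + 1) → R) (y : Fin (m - r) → R)
    (z : Fin (n - m + 1) → R) :
    g (evalF F x y z) = evalF F (fun i => g (x i)) (fun j => g (y j)) (fun k => g (z k)) := by
  have h := comp_aeval_apply (f := Sum.elim x (Sum.elim y z)) g.toIntAlgHom F
  refine Eq.trans ?_ (h.trans ?_)
  · rfl
  · rw [evalF]
    congr 2
    funext i
    rcases i with i | j | k <;> rfl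

theorem Ibeta_eq_integral_indicator (F : MvPolynomial (Idx n m r) ℤ) (B : ℝ) :
    Ibeta F B = ∫ t, (coordRegion n m r).indicator (fun t => eexp (B * aeval t F)) t := by
  have h1 := (volume_measurePreserving_sumPiEquivProdPi
    (fun _ : Fin (r + 1) ⊕ (Fin (m - r) ⊕ Fin (n - m + 1)) => ℝ))
  have h2 := (MeasurePreserving.id (volume : Measure (Fin (r + 1) → ℝ))).prod
    (volume_measurePreserving_sumPiEquivProdPi (fun _ : Fin (m - r) ⊕ Fin (n - m + 1) => ℝ))
  have h3 := h2.comp h1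
  have hemb : MeasurableEmbedding
      ((Prod.map id (MeasurableEquiv.sumPiEquivProdPi
        (fun _ : Fin (m - r) ⊕ Fin (n - m + 1) => ℝ))) ∘
      (MeasurableEquiv.sumPiEquivProdPi
        (fun _ : Fin (r + 1) ⊕ (Fin (m - r) ⊕ Fin (n - m + 1)) => ℝ))) :=
    (((MeasurableEquiv.refl _).prodCongr
      (MeasurableEquiv.sumPiEquivProdPi _)).measurableEmbedding).comp
        (MeasurableEquiv.measurableEmbedding _)
  rw [Ibeta]
  refine (h3.integral_comp hemb _).symm.trans (integral_congr_ae (.of_forall fun t => ?_))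
  simp only [Set.indicator_apply, mem_coordRegion_iff, ← evalF_eq_aeval]
  rfl

theorem Saqd_eq_sum (F : MvPolynomial (Idx n m r) ℤ) (d a q : ℕ)
    [Fintype (Idx n m r → ZMod q)] : Saqd F d a q = ∑ b : Idx n m r → ZMod q, eexp ((a : ℝ) / (q : ℝ) *
      ((evalF F (fun i => (d : ZMod q) * b (Sum.inl i)) (fun j => b (Sum.inr (Sum.inl j)))
        (fun k => b (Sum.inr (Sum.inr k)))).val : ℝ)) := by
  rw [Saqd, ← (splitEquiv n m r (ZMod q)).tsum_eq, tsum_fintype]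
  rfl

theorem eexp_div_mul_val (a q : ℕ) [NeZero q] (k : ℤ) :
    eexp ((a : ℝ) / q * ((k : ZMod q).val : ℝ)) = eexp ((a : ℝ) / q * k) := by
  have hq : (q : ℝ) ≠ 0 := by exact_mod_cast NeZero.ne q
  have h : ((k : ZMod q).val : ℝ) = k - q * (k / (q : ℤ) : ℤ) := by
    have h1 : ((k : ZMod q).val : ℤ) = k - q * (k / (q : ℤ)) := by
      rw [ZMod.val_intCast, Int.emod_def]
    exact_mod_cast congrArg (Int.cast : ℤ → ℝ) h1
  have h2 : (a : ℝ) / q * k = (a : ℝ) / q * (k - q * (k / (q : ℤ) : ℤ)) +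
      ((a * (k / (q : ℤ)) : ℤ) : ℝ) := by
    push_cast
    field_simp
    ring
  rw [h, h2, eexp_add, eexp_intCast, mul_one]

/-- The side lengths of the box underlying `Sd`. -/
def boxScale (n m r d : ℕ) (P₁ P₂ : ℝ) : Idx n m r → ℝ :=
  Sum.elim (fun _ => P₁) (Sum.elim (fun _ => d * P₁ * P₂) fun _ => P₂)

theorem prod_boxScale (hrm : r ≤ m) (hmn : m ≤ n) (d : ℕ) (P₁ P₂ : ℝ) :
    ∏ i, boxScale n m r d P₁ P₂ i = (d : ℝ) ^ (m - r) * P₁ ^ (m + 1) * P₂ ^ (n - r + 1) := by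
  simp only [boxScale, Fintype.prod_sum_type, Sum.elim_inl, Sum.elim_inr, Finset.prod_const,
    Finset.card_univ, Fintype.card_fin, mul_pow]
  rw [show m + 1 = (r + 1) + (m - r) by lia, show n - r + 1 = (m - r) + (n - m + 1) by lia,
    pow_add, pow_add _ (m - r)]
  ring

theorem Sd_eq_tsum {d₁ d₂ : ℕ} {F : MvPolynomial (Idx n m r) ℤ} (hF : Bihomogeneous F d₁ d₂)
    {d : ℕ} (hd : 1 ≤ d) {P₁ P₂ : ℝ} (hP₁ : 0 < P₁) (hP₂ : 0 < P₂) (a q : ℕ) [NeZero q] (α : ℝ) :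
    Sd F d P₁ P₂ α = ∑' k : Idx n m r → ℤ,
      (fun b : Idx n m r → ZMod q => eexp ((a : ℝ) / (q : ℝ) *
        ((evalF F (fun i => (d : ZMod q) * b (Sum.inl i)) (fun j => b (Sum.inr (Sum.inl j)))
          (fun k => b (Sum.inr (Sum.inr k)))).val : ℝ))) (fun i => (k i : ZMod q)) *
      (coordRegion n m r).indicator (fun t => eexp ((d : ℝ) ^ d₁ * (P₁ ^ d₁ * P₂ ^ d₂) *
        (α - a / q) * aeval t F)) (fun i => k i / boxScale n m r d P₁ P₂ i) := by
  have hd0 : (0 : ℝ) < d := by exact_mod_cast hd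
  rw [Sd, ← (splitEquiv n m r ℤ).tsum_eq]
  refine tsum_congr fun k => ?_
  set x : Fin (r + 1) → ℤ := fun i => k (Sum.inl i) with hx
  set y : Fin (m - r) → ℤ := fun j => k (Sum.inr (Sum.inl j)) with hy
  set z : Fin (n - m + 1) → ℤ := fun l => k (Sum.inr (Sum.inr l)) with hz
  have hk : splitEquiv n m r ℤ k = (x, y, z) := rfl
  have hnorm : ∀ {l : ℕ} (v : Fin l → ℤ) {c : ℝ}, 0 < c →
      ‖fun i => (v i : ℝ) / c‖ = ‖v‖ / c := by
    intro l v c hc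
    have e : (fun i => (v i : ℝ) / c) = c⁻¹ • fun i => (v i : ℝ) := by
      funext i; simp [div_eq_inv_mul]
    have e' : ‖fun i => (v i : ℝ)‖ = ‖v‖ := by
      simp only [Pi.norm_def]
      congr 2
    rw [e, norm_smul, e', norm_inv, Real.norm_eq_abs, abs_of_pos hc, div_eq_inv_mul]
  have hmem : (fun i => (k i : ℝ) / boxScale n m r d P₁ P₂ i) ∈ coordRegion n m r ↔
      ‖x‖ ≤ P₁ ∧ ‖y‖ ≤ d * ‖x‖ * P₂ ∧ ‖z‖ ≤ P₂ := by
    rw [mem_coordRegion_iff]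
    change ‖fun i => (x i : ℝ) / P₁‖ ≤ 1 ∧ ‖fun i => (y i : ℝ) / (d * P₁ * P₂)‖ ≤
      ‖fun i => (x i : ℝ) / P₁‖ ∧ ‖fun i => (z i : ℝ) / P₂‖ ≤ 1 ↔ _
    rw [hnorm x hP₁, hnorm y (by positivity), hnorm z hP₂, div_le_one hP₁, div_le_one hP₂,
      div_le_div_iff₀ (by positivity) hP₁]
    have : ‖y‖ * P₁ ≤ ‖x‖ * (d * P₁ * P₂) ↔ ‖y‖ ≤ d * ‖x‖ * P₂ := by
      rw [show ‖x‖ * (d * P₁ * P₂) = d * ‖x‖ * P₂ * P₁ by ring, mul_le_mul_iff_left₀ hP₁]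
    rw [this]
  rw [Set.indicator_apply, hk]
  by_cases h : ‖x‖ ≤ P₁ ∧ ‖y‖ ≤ d * ‖x‖ * P₂ ∧ ‖z‖ ≤ P₂
  swap
  · rw [if_neg h, if_neg (fun h' => h (hmem.1 h')), mul_zero]
  rw [if_pos h, if_pos (hmem.2 h)]
  set N : ℤ := evalF F (fun i => (d : ℤ) * x i) y z with hN
  have e1 : evalF F (fun i => (d : ZMod q) * (k (Sum.inl i) : ZMod q))
      (fun j => (k (Sum.inr (Sum.inl j)) : ZMod q))
      (fun l => (k (Sum.inr (Sum.inr l)) : ZMod q)) = (N : ZMod q) := by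
    have := map_evalF (Int.castRingHom (ZMod q)) F (fun i => (d : ℤ) * x i) y z
    simpa using this.symm
  have e2 : (d : ℝ) ^ d₁ * (P₁ ^ d₁ * P₂ ^ d₂) *
      aeval (fun i => (k i : ℝ) / boxScale n m r d P₁ P₂ i) F = N := by
    have h1 := map_evalF (Int.castRingHom ℝ) F (fun i => (d : ℤ) * x i) y z
    have h2 := hF ℝ (d * P₁) P₂ (fun i => (x i : ℝ) / P₁) (fun j => (y j : ℝ) / (d * P₁ * P₂))
      (fun l => (z l : ℝ) / P₂)
    rw [← evalF_eq_aeval, ← mul_assoc, ← mul_pow]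
    refine h2.symm.trans (Eq.trans ?_ h1.symm)
    congr 1 <;> funext i <;> simp <;> field_simp
  simp only [e1]
  rw [eexp_div_mul_val, ← eexp_add]
  congr 1
  rw [mul_right_comm, e2]
  ring

end Bihomogeneous

/-!
Statement 5 (major arc approximation): let `1 ≤ P₂ ≤ P₁`, `P := P₁^{d₁} P₂^{d₂}`,
`d̃ := d₁ + d₂ - 2`, `θ₀ ∈ [0,1]`, and let `a, q` be integers with
`1 ≤ q ≤ d P^{(d̃+1)θ₀}`, `0 ≤ a < q`, `gcd(a,q) = 1`.  Then for every `α ∈ [0,1]`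
with `|αq - a| ≤ q d^{-d₁} P^{-1+(d̃+1)θ₀}`, writing `β := α - a/q`:
`S_d(α) = d^{m-r} P₁^{m+1} P₂^{n-r+1} q^{-(n+2)} S_{a,q,d} I(d^{d₁} P β)
  + O(d^{m-r+1} P₁^{m+1} P₂^{n-r+1} P^{2(d̃+1)θ₀} P₂^{-1})`,
the implied constant depending only on `F, n, m, r`.
-/
theorem statement5
    (n m r d₁ d₂ : ℕ) (hr1 : 1 ≤ r) (hrm : r ≤ m) (hmn : m ≤ n)
    (hd₁ : 1 ≤ d₁) (hd₂ : 1 ≤ d₂) (hdm : d₁ < m + 1) (hdn : d₂ < n - r + 1)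
    (F : MvPolynomial (Idx n m r) ℤ) (hF : Bihomogeneous F d₁ d₂) :
    ∃ Cc : ℝ, 0 < Cc ∧
      ∀ d : ℕ, 1 ≤ d → ∀ P₁ P₂ : ℝ, 1 ≤ P₂ → P₂ ≤ P₁ →
      ∀ θ₀ : ℝ, 0 ≤ θ₀ → θ₀ ≤ 1 →
      ∀ q a : ℕ, 1 ≤ q →
        (q : ℝ) ≤ d * (P₁ ^ d₁ * P₂ ^ d₂) ^ ((((d₁ + d₂ - 2 : ℕ) : ℝ) + 1) * θ₀) →
        a < q → Nat.gcd a q = 1 →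
      ∀ α : ℝ, 0 ≤ α → α ≤ 1 →
        |α * q - a| ≤
          q * ((d : ℝ) ^ d₁)⁻¹ *
            (P₁ ^ d₁ * P₂ ^ d₂) ^ (-1 + (((d₁ + d₂ - 2 : ℕ) : ℝ) + 1) * θ₀) →
        ‖Sd F d P₁ P₂ α -
            (((d : ℝ) ^ (m - r) * P₁ ^ (m + 1) * P₂ ^ (n - r + 1) *
                (q : ℝ) ^ (-((n : ℤ) + 2)) : ℝ) : ℂ) *
              Saqd F d a q *
              Ibeta F ((d : ℝ) ^ d₁ * (P₁ ^ d₁ * P₂ ^ d₂) * (α - a / q))‖ ≤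
          Cc * (d : ℝ) ^ (m - r + 1) * P₁ ^ (m + 1) * P₂ ^ (n - r + 1) *
            (P₁ ^ d₁ * P₂ ^ d₂) ^ (2 * (((d₁ + d₂ - 2 : ℕ) : ℝ) + 1) * θ₀) * P₂⁻¹ := by
  obtain ⟨L, hL, hFL⟩ := exists_lipschitz_on_unit_ball F
  set N : ℕ := Fintype.card (Idx n m r) with hN
  have hNn : N = n + 2 := by simp [hN, Idx]; lia
  refine ⟨4 ^ N * (2 * Real.pi * L + 2 * N + 2), by positivity, ?_⟩
  intro d hd P₁ P₂ hP₂ hP₁₂ θ₀ hθ0 hθ1 q a hq hqle haq hgcd α hα0 hα1 hα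
  have : NeZero q := ⟨by lia⟩
  have hP₂0 : 0 < P₂ := by linarith
  have hP₁0 : 0 < P₁ := by linarith
  have hd1 : (1 : ℝ) ≤ d := by exact_mod_cast hd
  have hd0 : (0 : ℝ) < d := by linarith
  have hq0 : (0 : ℝ) < q := by exact_mod_cast hq
  set κ : ℝ := (((d₁ + d₂ - 2 : ℕ) : ℝ) + 1) * θ₀ with hκ
  have hκ0 : 0 ≤ κ := by positivity
  set P : ℝ := P₁ ^ d₁ * P₂ ^ d₂ with hP
  have hP1 : 1 ≤ P := one_le_mul_of_one_le_of_one_le (one_le_pow₀ (by linarith))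
    (one_le_pow₀ hP₂)
  have hP0 : 0 < P := by linarith
  set K : ℝ := P ^ κ with hK
  have hK1 : 1 ≤ K := Real.one_le_rpow hP1 hκ0
  have hK2 : P ^ (2 * (((d₁ + d₂ - 2 : ℕ) : ℝ) + 1) * θ₀) = K ^ 2 := by
    rw [hK, ← Real.rpow_natCast, ← Real.rpow_mul hP0.le, hκ]
    push_cast
    ring_nf
  set B : ℝ := (d : ℝ) ^ d₁ * P * (α - a / q) with hB
  have hBK : |B| ≤ K := by
    rw [Real.rpow_add hP0, Real.rpow_neg_one] at hα
    have h1 : α * q - a = q * (α - a / q) := by field_simp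
    rw [h1, abs_mul, abs_of_pos hq0, mul_assoc, mul_le_mul_iff_right₀ hq0] at hα
    rw [hB, abs_mul, abs_of_pos (by positivity)]
    calc _ ≤ (d : ℝ) ^ d₁ * P * (((d : ℝ) ^ d₁)⁻¹ * (P⁻¹ * P ^ κ)) := by gcongr
      _ = K := by rw [hK]; field_simp
  have hcont : Continuous fun t : Idx n m r → ℝ => aeval t F := by
    simpa only [eval_map, aeval_def] using continuous_eval (F.map (algebraMap ℤ ℝ))
  have key := norm_weighted_sum_sub_le (lipschitzWith_coordBound (n := n) (m := m) (r := r))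
    (fun i t x => by convert coordBound_update i t x) (D := coordRegion n m r) (fun t => Iff.rfl)
    coordRegion_subset
    (f := fun t => eexp (B * aeval t F))
    (continuous_eexp.comp (continuous_const.mul hcont))
    (fun t => (norm_eexp _).le) (M := 2 * Real.pi * (|B| * L)) (by positivity)
    (fun t ht t' ht' => by
      refine (norm_eexp_sub_le _ _).trans ?_
      rw [← mul_sub, abs_mul, mul_assoc, mul_assoc, mul_assoc, mul_assoc]
      gcongr
      exact hFL t t' (by simpa using coordRegion_subset ht)
        (by simpa using coordRegion_subset ht'))
    (q := q)
    (w := fun b => eexp ((a : ℝ) / (q : ℝ) *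
        ((evalF F (fun i => (d : ZMod q) * b (Sum.inl i)) (fun j => b (Sum.inr (Sum.inl j)))
          (fun k => b (Sum.inr (Sum.inr k)))).val : ℝ)))
    (fun b => (norm_eexp _).le) hP₂ (σ := boxScale n m r d P₁ P₂)
    (fun i => by
      have h1 : 1 ≤ d * P₁ := one_le_mul_of_one_le_of_one_le hd1 (by linarith)
      rcases i with i | j | k
      · exact hP₁₂
      · exact le_mul_of_one_le_left hP₂0.le h1
      · exact le_rfl)
  rw [← Saqd_eq_sum, ← Ibeta_eq_integral_indicator,
    prod_boxScale hrm hmn, ← hN] at key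
  have hzpow : (q : ℝ) ^ (-((n : ℤ) + 2)) = ((q : ℝ) ^ N)⁻¹ := by
    rw [hNn, zpow_neg]
    norm_cast
  rw [hzpow, hK2]
  have ecast : ((((d : ℝ) ^ (m - r) * P₁ ^ (m + 1) * P₂ ^ (n - r + 1) * ((q : ℝ) ^ N)⁻¹ : ℝ)) : ℂ)
      = (((d : ℝ) ^ (m - r) * P₁ ^ (m + 1) * P₂ ^ (n - r + 1) : ℝ) : ℂ) * ((q : ℂ) ^ N)⁻¹ := by
    push_cast
    ring
  rw [ecast, Sd_eq_tsum hF hd hP₁0 hP₂0 a q α]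
  refine key.trans ?_
  have hM : 2 * Real.pi * (|B| * L) + 2 * N + 2 ≤ K * (2 * Real.pi * L + 2 * N + 2) := by
    have h1 : 2 * Real.pi * (|B| * L) ≤ 2 * Real.pi * (K * L) := by gcongr
    have h2 : (2 * N + 2 : ℝ) ≤ K * (2 * N + 2) := le_mul_of_one_le_left (by positivity) hK1
    linarith
  calc _ ≤ (d : ℝ) ^ (m - r) * P₁ ^ (m + 1) * P₂ ^ (n - r + 1) *
        (4 ^ N * (d * K / P₂) * (K * (2 * Real.pi * L + 2 * N + 2))) := by gcongr
    _ = _ := by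
        rw [pow_succ (d : ℝ) (m - r)]
        field_simp

end PaperTM
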